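/- arXiv:2209.08999 — 5 statements merged into one kernel-verified Lean document; each statement's English description precedes it below -/
import Mathlib

section
/- Let (A_1,…,A_ℓ) be invertible d×d real matrices. Suppose that for every positive integer t dividing d the cocycle 𝒜^t is irreducible (no subspace V of ℝ^d with V ≠ {0} and V ≠ ℝ^d satisfies A_I V ⊆ V for every word I of length t), and that for every 1 ≤ m ≤ d−1 the cocycle 𝒜^{∧m} is irreducible (no subspace W of ⋀^m ℝ^d with W ≠ {0} and W ≠ ⋀^m ℝ^d satisfies (⋀^m A_i) W ⊆ W for every i). Then the cocycle is k-quasi-multiplicative for some k ∈ ℕ: there exists c > 0 such that for all finite words I, J there exists a word K of length exactly k with ‖A_{IKJ}‖ ≥ c ‖A_I‖ ‖A_J‖, where IKJ denotes concatenation. -/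
open Matrix

/-- For a word `I = [i₀, i₁, …, i_{n-1}]`, the cocycle product
`A_I = A_{i_{n-1}} ⋯ A_{i₀}`. -/
noncomputable def wordProd {ℓ d : ℕ} (A : Fin ℓ → Matrix (Fin d) (Fin d) ℝ)
    (I : List (Fin ℓ)) : Matrix (Fin d) (Fin d) ℝ :=
  I.foldl (fun B i => A i * B) 1

/-- The operator norm of a matrix, viewed as a linear operator on Euclidean space. -/
noncomputable def opNorm {d : ℕ} (M : Matrix (Fin d) (Fin d) ℝ) : ℝ :=
  ‖Matrix.toEuclideanCLM (𝕜 := ℝ) M‖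

theorem ExteriorAlgebra.ιMulti_ne_zero_of_linearIndependent {K M : Type*} [Field K]
    [AddCommGroup M] [Module K M] {n : ℕ} {v : Fin n → M} (hv : LinearIndependent K v) :
    ExteriorAlgebra.ιMulti K n v ≠ 0 := by
  classical
  obtain ⟨p, hp⟩ := LinearMap.exists_leftInverse_of_injective
    (Fintype.linearCombination K v) (LinearMap.ker_eq_bot.2
      hv.fintypeLinearCombination_injective)
  have hpv (i : Fin n) : p (v i) = Pi.single i 1 := by
    simpa using LinearMap.congr_fun hp (Pi.single i 1)
  let f : M [⋀^Fin n]→ₗ[K] K := (Matrix.detRowAlternating (R := K) (n := Fin n)).compLinearMap p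
  have hf : f v = 1 := by
    have : (fun i => p (v i)) = (1 : Matrix (Fin n) (Fin n) K) := by
      funext i
      rw [hpv]
      ext j
      simp [Matrix.one_apply, Pi.single_apply, eq_comm]
    simp only [f, AlternatingMap.compLinearMap_apply]
    erw [this]
    exact Matrix.det_one
  intro h
  have h0 : exteriorPower.ιMulti K n v = 0 := Subtype.ext h
  have := exteriorPower.alternatingMapLinearEquiv_apply_ιMulti f v
  rw [h0, map_zero, hf] at this
  exact zero_ne_one this

theorem AlternatingMap.map_apply_eq_det_smul {K V N : Type*} [Field K] [AddCommGroup V]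
    [Module K V] [FiniteDimensional K V] [AddCommGroup N] [Module K N] {n : ℕ}
    (hn : Module.finrank K V = n) (f : V [⋀^Fin n]→ₗ[K] N) (g : V →ₗ[K] V) (v : Fin n → V) :
    f (g ∘ v) = LinearMap.det g • f v := by
  let e : Module.Basis (Fin n) K V := Module.finBasisOfFinrankEq K V hn
  suffices h : ∀ w, f w = e.det w • f e by
    rw [h (g ∘ v), h v, e.det_comp, mul_smul]
  intro w
  have : f = (LinearMap.toSpanSingleton K N (f e)).compAlternatingMap e.det := by
    refine e.ext_alternating fun σ hσ => ?_
    have hb : Function.Bijective σ := Finite.injective_iff_bijective.1 hσ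
    let s := Equiv.ofBijective σ hb
    have h1 : (fun i => e (σ i)) = e ∘ s := rfl
    rw [h1, AlternatingMap.map_perm, AlternatingMap.map_perm]
    simp [e.det_self]
  conv_lhs => rw [this]
  simp

/-- An invertible operator multiplying every decomposable `m`-vector by the same constant,
with `1 ≤ m < dim`, is a homothety. -/
theorem LinearMap.exists_eq_smul_one_of_ιMulti {K M : Type*} [Field K] [AddCommGroup M]
    [Module K M] [FiniteDimensional K M] {m : ℕ} (hm : 1 ≤ m) (hm' : m < Module.finrank K M)
    (r : M →ₗ[K] M) {δ : K} (hδ : δ ≠ 0)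
    (h : ∀ v : Fin m → M, ExteriorAlgebra.ιMulti K m (r ∘ v) = δ • ExteriorAlgebra.ιMulti K m v) :
    ∃ c : K, r = c • (1 : M →ₗ[K] M) := by
  refine LinearMap.exists_eq_smul_id_of_forall_notLinearIndependent fun x hx => ?_
  obtain ⟨m, rfl⟩ := Nat.exists_eq_add_of_le' hm
  have hx' : LinearIndependent K ![r x, x] := LinearIndependent.pair_symm_iff.1 hx
  obtain ⟨y, hy0, hy1, hy⟩ : ∃ y : Fin (m + 2) → M, y 0 = r x ∧ y 1 = x ∧
      LinearIndependent K y := by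
    clear h hx
    induction m with
    | zero => exact ⟨_, rfl, rfl, hx'⟩
    | succ m ih =>
      obtain ⟨y, hy0, hy1, hy⟩ := ih (by omega) (by omega)
      obtain ⟨z, hz⟩ : ∃ z, z ∉ Submodule.span K (Set.range y) := by
        by_contra! hcon
        have : Submodule.span K (Set.range y) = ⊤ := Submodule.eq_top_iff'.2 hcon
        have h2 := finrank_span_eq_card hy
        rw [this, finrank_top] at h2
        simp at h2
        omega
      refine ⟨Fin.snoc y z, ?_, ?_, linearIndependent_finSnoc.2 ⟨hy, hz⟩⟩
      · rw [← hy0]; exact Fin.snoc_castSucc (α := fun _ => M) z y 0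
      · rw [← hy1]; exact Fin.snoc_castSucc (α := fun _ => M) z y 1
  have key := h (Fin.tail y)
  have h1 : ExteriorAlgebra.ι K (r x) * ExteriorAlgebra.ιMulti K (m + 1) (r ∘ Fin.tail y) = 0 := by
    rw [ExteriorAlgebra.ιMulti_succ_apply, ← mul_assoc]
    have : (r ∘ Fin.tail y) 0 = r x := by simp [Fin.tail, hy1]
    rw [this, ExteriorAlgebra.ι_sq_zero, zero_mul]
  have h2 : ExteriorAlgebra.ι K (r x) * ExteriorAlgebra.ιMulti K (m + 1) (Fin.tail y)
      = ExteriorAlgebra.ιMulti K (m + 2) y := by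
    rw [ExteriorAlgebra.ιMulti_succ_apply (n := m + 1) y, hy0]
    rfl
  rw [key, mul_smul_comm, h2] at h1
  exact ExteriorAlgebra.ιMulti_ne_zero_of_linearIndependent hy ((smul_eq_zero.1 h1).resolve_left hδ)

/-- If every nonzero proper subspace of `⋀^m M` fails to be invariant under the `a i`, and the
`a i` permute a sequence of `m`-dimensional subspaces, then an invertible operator acting on
all of these with the same determinant is a homothety. -/
theorem LinearMap.exists_eq_smul_one_of_det_restrict {K M ι : Type*} [Field K] [AddCommGroup M]
    [Module K M] [FiniteDimensional K M] (a : ι → M ≃ₗ[K] M) {m : ℕ} (hm : 1 ≤ m)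
    (hm' : m < Module.finrank K M)
    (hext : ∀ W : Submodule K (ExteriorAlgebra K M), W ≤ ⋀[K]^m M → W ≠ ⊥ →
      (∀ i, W.map (ExteriorAlgebra.map (a i).toLinearMap).toLinearMap ≤ W) → W = ⋀[K]^m M)
    (V : ℕ → Submodule K M) (hV : ∀ i k, (V k).map (a i).toLinearMap = V (k + 1))
    (hVm : ∀ k, Module.finrank K (V k) = m) (r : M ≃ₗ[K] M)
    (hr : ∀ k, ∀ x ∈ V k, r.toLinearMap x ∈ V k) {δ : K} 
    (hdet : ∀ k, LinearMap.det (r.toLinearMap.restrict (hr k)) = δ) :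
    ∃ c : K, r.toLinearMap = c • (1 : M →ₗ[K] M) := by
  have hδ : δ ≠ 0 := by
    rw [← hdet 0]
    intro h0
    have hinj : Function.Injective (r.toLinearMap.restrict (hr 0)) := by
      intro x y hxy
      have := congrArg Subtype.val hxy
      exact Subtype.ext (r.injective (by simpa using this))
    exact (LinearEquiv.isUnit_det' (LinearEquiv.ofInjectiveEndo _ hinj)).ne_zero h0
  refine exists_eq_smul_one_of_ιMulti hm hm' _ hδ ?_
  let S : Set (ExteriorAlgebra K M) :=
    {w | ∃ (k : ℕ) (v : Fin m → M), (∀ i, v i ∈ V k) ∧ w = ExteriorAlgebra.ιMulti K m v}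
  have hS : Submodule.span K S = ⋀[K]^m M := by
    refine hext _ (Submodule.span_le.2 ?_) ?_ ?_
    · rintro _ ⟨k, v, -, rfl⟩
      exact ExteriorAlgebra.ιMulti_range K m ⟨v, rfl⟩
    · let b := Module.finBasisOfFinrankEq K (V 0) (hVm 0)
      have hb : LinearIndependent K (fun i => (b i : M)) :=
        b.linearIndependent.map' (V 0).subtype (Submodule.ker_subtype _)
      intro hbot
      have : ExteriorAlgebra.ιMulti K m (fun i => (b i : M)) ∈ Submodule.span K S :=
        Submodule.subset_span ⟨0, _, fun i => (b i).2, rfl⟩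
      rw [hbot, Submodule.mem_bot] at this
      exact ExteriorAlgebra.ιMulti_ne_zero_of_linearIndependent hb this
    · intro i
      rw [Submodule.map_span, Submodule.span_le]
      rintro _ ⟨_, ⟨k, v, hv, rfl⟩, rfl⟩
      refine Submodule.subset_span ⟨k + 1, a i ∘ v, fun j => ?_, ?_⟩
      · rw [← hV i k]; exact ⟨v j, hv j, rfl⟩
      · exact ExteriorAlgebra.map_apply_ιMulti _ _
  intro v
  have hmem : ExteriorAlgebra.ιMulti K m v ∈ Submodule.span K S := by
    rw [hS]; exact ExteriorAlgebra.ιMulti_range K m ⟨v, rfl⟩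
  rw [← ExteriorAlgebra.map_apply_ιMulti]
  generalize ExteriorAlgebra.ιMulti K m v = w at hmem
  induction hmem using Submodule.span_induction with
  | zero => simp
  | add x y _ _ hx hy => rw [map_add, hx, hy, smul_add]
  | smul c x _ hx => rw [map_smul, hx, smul_comm]
  | mem x hx =>
    obtain ⟨k, v, hv, rfl⟩ := hx
    rw [ExteriorAlgebra.map_apply_ιMulti]
    have := AlternatingMap.map_apply_eq_det_smul (hVm k)
      ((ExteriorAlgebra.ιMulti K m).compLinearMap (V k).subtype)
      (r.toLinearMap.restrict (hr k)) (fun i => ⟨v i, hv i⟩)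
    rw [hdet k] at this
    exact this

section SemilinearIsotypic

variable {R M : Type*} [Ring R] [AddCommGroup M] [Module R M]
  {σ σ' : R →+* R} [RingHomInvPair σ σ'] [RingHomInvPair σ' σ]

theorem Submodule.nonempty_linearEquiv_map_iff (G : M ≃ₛₗ[σ] M) (N S : Submodule R M) :
    Nonempty (N.map (G : M →ₛₗ[σ] M) ≃ₗ[R] S.map (G : M →ₛₗ[σ] M)) ↔ Nonempty (N ≃ₗ[R] S) := by
  constructor
  · rintro ⟨e⟩
    exact ⟨((G.submoduleMap N).trans e).trans (G.submoduleMap S).symm⟩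
  · rintro ⟨e⟩
    exact ⟨((G.submoduleMap N).symm.trans e).trans (G.submoduleMap S)⟩

theorem map_isotypicComponent (G : M ≃ₛₗ[σ] M) (S : Submodule R M) :
    (isotypicComponent R M S).map (G : M →ₛₗ[σ] M) =
      isotypicComponent R M (S.map (G : M →ₛₗ[σ] M)) := by
  let o : Submodule R M ≃o Submodule R M := Submodule.orderIsoMapComap G
  have ho : ∀ N, o N = N.map (G : M →ₛₗ[σ] M) := fun N => rfl
  rw [isotypicComponent, isotypicComponent, ← ho, o.map_sSup_eq_sSup_symm_preimage]
  congr 1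
  ext N
  simp only [Set.mem_preimage, Set.mem_ofPred_eq]
  rw [← Submodule.nonempty_linearEquiv_map_iff G, ← ho, o.apply_symm_apply]

theorem isSimpleModule_map (G : M ≃ₛₗ[σ] M) (S : Submodule R M) [hS : IsSimpleModule R S] :
    IsSimpleModule R (S.map (G : M →ₛₗ[σ] M)) := by
  rw [isSimpleModule_iff_isAtom] at hS ⊢
  exact ((Submodule.orderIsoMapComap G).isAtom_iff S).2 hS

end SemilinearIsotypic

/-- A finite independent family of subspaces of the same dimension spanning the space. -/
theorem Submodule.finrank_eq_card_mul_of_iSupIndep {K M ι : Type*} [Field K] [AddCommGroup M]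
    [Module K M] [FiniteDimensional K M] [Fintype ι] {U : ι → Submodule K M}
    (hU : iSupIndep U) (htop : ⨆ i, U i = ⊤) {n : ℕ} (hn : ∀ i, Module.finrank K (U i) = n) :
    Module.finrank K M = Fintype.card ι * n := by
  classical
  have h : DirectSum.IsInternal U :=
    DirectSum.isInternal_submodule_of_iSupIndep_of_iSup_eq_top hU htop
  rw [← (LinearEquiv.ofBijective (DirectSum.coeLinearMap U) h).finrank_eq,
    Module.finrank_directSum]
  simp [hn]

/-- A version of Clifford's theorem for a cyclic group: if a semilinear automorphism `G` leaves
no nontrivial system of imprimitivity, then all simple submodules are isomorphic. -/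
theorem nonempty_linearEquiv_of_imprimitivity_trivial {K R M : Type*} [Field K] [Ring R]
    [Algebra K R] [AddCommGroup M] [Module K M] [FiniteDimensional K M] [Module R M]
    [IsScalarTower K R M] {σ σ' : R →+* R} [RingHomInvPair σ σ'] [RingHomInvPair σ' σ]
    (G : M ≃ₛₗ[σ] M) (hG : ∀ (c : K) x, G (c • x) = c • G x)
    (hirr : ∀ t : ℕ, 0 < t → t ∣ Module.finrank K M → ∀ U : ℕ → Submodule R M,
      (∀ k, (U k).map (G : M →ₛₗ[σ] M) = U (k + 1)) → U t = U 0 → U 0 = ⊥ ∨ U 0 = ⊤)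
    (W W' : Submodule R M) [IsSimpleModule R W] [IsSimpleModule R W'] :
    Nonempty (W' ≃ₗ[R] W) := by
  have hnoeth : IsNoetherian R M := isNoetherian_of_tower K inferInstance
  let f : isotypicComponents R M → isotypicComponents R M := fun c =>
    ⟨c.1.map (G : M →ₛₗ[σ] M), by
      obtain ⟨c, S, hS, rfl⟩ := c
      exact ⟨_, isSimpleModule_map G S, map_isotypicComponent G S⟩⟩
  have hf : Function.Injective f := fun c c' h =>
    Subtype.ext ((Submodule.orderIsoMapComap G).injective (congrArg Subtype.val h))
  let c₀ : isotypicComponents R M := ⟨isotypicComponent R M W, W, inferInstance, rfl⟩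
  set p := Function.minimalPeriod f c₀ with hp
  have hp0 : 0 < p := Function.minimalPeriod_pos_of_mem_periodicPts (hf.mem_periodicPts c₀)
  let U : ℕ → Submodule R M := fun k => (f^[k] c₀).1
  have hU (k) : (U k).map (G : M →ₛₗ[σ] M) = U (k + 1) := by
    simp only [U, Function.iterate_succ_apply']
    rfl
  have hUp (k) : U (k + p) = U k := by
    simp only [U, Function.iterate_add_apply]
    rw [Function.iterate_minimalPeriod]
  have hU0 : U 0 ≠ ⊥ := (bot_lt_isotypicComponents c₀.2).ne'
  have htop : ⨆ i : Fin p, U i = ⊤ := by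
    have hall : ⨆ i : Fin p, U i = ⨆ k, U k := by
      refine le_antisymm (iSup_le fun i => le_iSup U i) (iSup_le fun k => ?_)
      have : U k = U (k % p) := by
        conv_lhs => rw [← Nat.mod_add_div k p]
        induction k / p with
        | zero => simp
        | succ n ih => rw [Nat.mul_succ, ← add_assoc, hUp, ih]
      rw [this]
      exact le_iSup (fun i : Fin p => U i) ⟨k % p, Nat.mod_lt _ hp0⟩
    have hinv : (⨆ k, U k).map (G : M →ₛₗ[σ] M) = ⨆ k, U k := by
      rw [Submodule.map_iSup]
      simp only [hU]
      refine le_antisymm (iSup_le fun k => le_iSup U (k + 1)) (iSup_le fun k => ?_)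
      rw [← hUp, show k + p = (k + (p - 1)) + 1 by omega]
      exact le_iSup (fun k => U (k + 1)) _
    rw [hall]
    refine (hirr 1 one_pos (one_dvd _) (fun _ => ⨆ k, U k) (fun _ => hinv) rfl).resolve_left ?_
    exact fun h => hU0 (eq_bot_iff.2 (h ▸ le_iSup U 0))
  have hind : iSupIndep fun i : Fin p => U i := by
    have h1 := (sSupIndep_iff _).1 (sSupIndep_isotypicComponents R M)
    have hinj : Function.Injective fun i : Fin p => f^[i] c₀ := fun i j hij =>
      Fin.ext (Function.iterate_injOn_Iio_minimalPeriod i.2 j.2 hij)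
    exact h1.comp hinj
  have hdim (k) : Module.finrank K ((U k).restrictScalars K) =
      Module.finrank K ((U 0).restrictScalars K) := by
    induction k with
    | zero => rfl
    | succ k ih =>
      rw [← ih, ← hU]
      let GK : M ≃ₗ[K] M := { G with map_smul' := hG }
      exact (LinearEquiv.finrank_map_eq GK ((U k).restrictScalars K))
  have hcard := Submodule.finrank_eq_card_mul_of_iSupIndep (K := K)
    (U := fun i : Fin p => (U i).restrictScalars K) ?_ ?_ (fun i => hdim i)
  · rw [Fintype.card_fin] at hcard
    have := (hirr p hp0 ⟨_, hcard⟩ U hU (by simpa using hUp 0)).resolve_left hU0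
    exact IsIsotypicOfType.of_isotypicComponent_eq_top this W'
  · intro i
    have := hind i
    rw [Submodule.disjoint_def] at this ⊢
    intro x hx hx'
    refine this x hx ?_
    have h2 : ⨆ j, ⨆ (_ : j ≠ i), (U j).restrictScalars K ≤
      (⨆ j, ⨆ (_ : j ≠ i), U j).restrictScalars K := by
      refine iSup₂_le fun j hj x hx => ?_
      exact (le_iSup₂ (f := fun (j : Fin p) (_ : j ≠ i) => U j) j hj) hx
    exact h2 hx'
  · rw [← Submodule.restrictScalars_iSup, htop]
    rfl

/-- Let `a j = G ∘ ρ j` with `ρ j` in a ring `R` normalized by `G`. If `R` has a nontrivial proper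
submodule, then under the irreducibility assumptions each `ρ j` acts as a homothety. -/
theorem exists_smul_eq_smul_of_semilinear {K R M ι : Type*} [Field K] [Ring R]
    [Algebra K R] [AddCommGroup M] [Module K M] [FiniteDimensional K M] [Module R M]
    [IsScalarTower K R M] {σ σ' : R →+* R} [RingHomInvPair σ σ'] [RingHomInvPair σ' σ]
    (G : M ≃ₛₗ[σ] M) (hG : ∀ (c : K) x, G (c • x) = c • G x)
    (a : ι → M ≃ₗ[K] M) (ρ : ι → R) (ha : ∀ j x, a j x = G (ρ j • x))
    (hirr : ∀ t : ℕ, 0 < t → t ∣ Module.finrank K M → ∀ U : ℕ → Submodule K M,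
      (∀ i k, (U k).map (a i).toLinearMap = U (k + 1)) → U t = U 0 → U 0 = ⊥ ∨ U 0 = ⊤)
    (hext : ∀ m : ℕ, 1 ≤ m → m < Module.finrank K M →
      ∀ W : Submodule K (ExteriorAlgebra K M), W ≤ ⋀[K]^m M → W ≠ ⊥ →
      (∀ i, W.map (ExteriorAlgebra.map (a i).toLinearMap).toLinearMap ≤ W) → W = ⋀[K]^m M)
    (V₀ : Submodule R M) (hbot : V₀ ≠ ⊥) (htop : V₀ ≠ ⊤) (j : ι) :
    ∃ c : K, ∀ x : M, ρ j • x = c • x := by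
  let g : M ≃ₗ[K] M := { G with map_smul' := hG }
  have hgG (x) : g x = G x := rfl
  have hmap (U : Submodule R M) (j) : (U.restrictScalars K).map (a j).toLinearMap =
      (U.map (G : M →ₛₗ[σ] M)).restrictScalars K := by
    refine Submodule.eq_of_le_of_finrank_eq ?_ ?_
    · rintro _ ⟨x, hx, rfl⟩
      exact ⟨_, U.smul_mem (ρ j) hx, (ha j x).symm⟩
    · exact (LinearEquiv.finrank_map_eq (a j) _).trans
        (LinearEquiv.finrank_map_eq g (U.restrictScalars K)).symm
  have : IsArtinian R M := isArtinian_of_tower K inferInstance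
  obtain ⟨W, hW, hWV⟩ := (eq_bot_or_exists_atom_le V₀).resolve_left hbot
  obtain ⟨T, hT0, hTsucc⟩ : ∃ T : ℕ → Submodule R M, T 0 = W ∧
      ∀ k, T (k + 1) = (T k).map (G : M →ₛₗ[σ] M) :=
    ⟨fun k => (fun N => N.map (G : M →ₛₗ[σ] M))^[k] W, rfl,
      fun k => Function.iterate_succ_apply' _ _ _⟩
  rw [← hT0] at hW hWV
  have hT (k) : IsSimpleModule R (T k) := by
    induction k with
    | zero => exact isSimpleModule_iff_isAtom.2 hW
    | succ k ih => exact hTsucc k ▸ isSimpleModule_map G (T k)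
  have hiso (k) : Nonempty (T k ≃ₗ[R] T 0) := by
    refine nonempty_linearEquiv_of_imprimitivity_trivial (K := K) G hG ?_ _ _
    intro t ht htd U hU hUt
    have := hirr t ht htd (fun k => (U k).restrictScalars K)
      (fun j k => by rw [hmap, hU]) (by simp only [hUt])
    simpa using this
  let e (k) : T k ≃ₗ[R] T 0 := (hiso k).some
  have hlt : Module.finrank K ((T 0).restrictScalars K) < Module.finrank K M :=
    Submodule.finrank_lt fun h => htop (eq_top_iff.2 (by
      rw [Submodule.restrictScalars_eq_top_iff] at h
      exact h ▸ hWV))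
  have hpos : 1 ≤ Module.finrank K ((T 0).restrictScalars K) := by
    rw [Nat.one_le_iff_ne_zero, Ne, Submodule.finrank_eq_zero]
    intro h
    exact hW.1 (by simpa using h)
  let r : M ≃ₗ[K] M := (a j).trans g.symm
  have hr (x) : r x = ρ j • x := by
    simp only [r, LinearEquiv.trans_apply]
    rw [LinearEquiv.symm_apply_eq, hgG, ha]
  have hrT (k) (x) (hx : x ∈ (T k).restrictScalars K) :
      r.toLinearMap x ∈ (T k).restrictScalars K := by
    rw [LinearEquiv.coe_coe, hr]
    exact (T k).smul_mem _ hx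
  let eK (k) : (T k).restrictScalars K ≃ₗ[K] (T 0).restrictScalars K :=
    { toFun := e k
      invFun := (e k).symm
      left_inv := (e k).left_inv
      right_inv := (e k).right_inv
      map_add' := (e k).map_add
      map_smul' := ((e k).restrictScalars K).map_smul }
  have heK (k) (x : (T k).restrictScalars K) :
      eK k (r.toLinearMap.restrict (hrT k) x) = r.toLinearMap.restrict (hrT 0) (eK k x) := by
    have h1 (k : ℕ) (y : T k) : r.toLinearMap.restrict (hrT k) y = (ρ j • y : T k) :=
      Subtype.ext (hr y)
    exact ((congrArg (e k) (h1 k x)).trans ((e k).map_smul _ _)).trans (h1 0 (e k x)).symm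
  have hdet (k) : LinearMap.det (r.toLinearMap.restrict (hrT k)) =
      LinearMap.det (r.toLinearMap.restrict (hrT 0)) := by
    rw [← LinearMap.det_conj (r.toLinearMap.restrict (hrT k)) (eK k)]
    congr 1
    refine LinearMap.ext fun x => ?_
    simp only [LinearMap.comp_apply, LinearEquiv.coe_coe]
    rw [heK, LinearEquiv.apply_symm_apply]
  obtain ⟨c, hc⟩ := LinearMap.exists_eq_smul_one_of_det_restrict a hpos hlt (hext _ hpos hlt)
    (fun k => (T k).restrictScalars K) (fun j k => hTsucc k ▸ hmap (T k) j)
    (fun k => (eK k).finrank_eq) r hrT hdet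
  exact ⟨c, fun x => (hr x).symm.trans (LinearMap.congr_fun hc x)⟩

/-- If invertible maps `a i` permute a sequence of nontrivial proper subspaces in the same way, then
under the irreducibility assumptions they are all proportional. -/
theorem exists_eq_smul_of_map_eq_succ {K M ι : Type*} [Field K] [AddCommGroup M]
    [Module K M] [FiniteDimensional K M] (a : ι → M ≃ₗ[K] M)
    (hirr : ∀ t : ℕ, 0 < t → t ∣ Module.finrank K M → ∀ U : ℕ → Submodule K M,
      (∀ i k, (U k).map (a i).toLinearMap = U (k + 1)) → U t = U 0 → U 0 = ⊥ ∨ U 0 = ⊤)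
    (hext : ∀ m : ℕ, 1 ≤ m → m < Module.finrank K M →
      ∀ W : Submodule K (ExteriorAlgebra K M), W ≤ ⋀[K]^m M → W ≠ ⊥ →
      (∀ i, W.map (ExteriorAlgebra.map (a i).toLinearMap).toLinearMap ≤ W) → W = ⋀[K]^m M)
    (V : ℕ → Submodule K M) (hV : ∀ i k, (V k).map (a i).toLinearMap = V (k + 1))
    (hbot : V 0 ≠ ⊥) (htop : V 0 ≠ ⊤) (i j : ι) :
    ∃ c : K, (a j).toLinearMap = c • (a i).toLinearMap := by
  set g := a i with hg
  let R : Subalgebra K (Module.End K M) :=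
    { carrier := {f | ∀ k, ∀ x ∈ V k, f x ∈ V k}
      mul_mem' := fun {f f'} hf hf' k x hx => hf k _ (hf' k x hx)
      add_mem' := fun {f f'} hf hf' k x hx => add_mem (hf k x hx) (hf' k x hx)
      algebraMap_mem' := fun c k x hx => by
        simpa [Module.algebraMap_end_apply] using (V k).smul_mem c hx }
  have hR (f : Module.End K M) : f ∈ R ↔ ∀ k, ∀ x ∈ V k, f x ∈ V k := Iff.rfl
  have hgV (k x) : g x ∈ V (k + 1) ↔ x ∈ V k := by
    rw [← hV i k]
    rw [Submodule.mem_map_equiv, hg, LinearEquiv.symm_apply_apply]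
  have hsymm (f : Module.End K M) (hf : f ∈ R) : g.symm.conj f ∈ R := by
    rw [hR]
    intro k x hx
    rw [← hgV]
    simpa [LinearEquiv.conj_apply] using hf (k + 1) (g x) ((hgV k x).2 hx)
  have hconj (f : Module.End K M) (hf : f ∈ R) : g.conj f ∈ R := by
    have hle : (Subalgebra.toSubmodule R).map g.symm.conj.toLinearMap ≤ Subalgebra.toSubmodule R := by
      rintro _ ⟨f, hf, rfl⟩
      exact hsymm f hf
    have heq := Submodule.eq_of_le_of_finrank_eq hle (LinearEquiv.finrank_map_eq _ _)
    have hf' : f ∈ (Subalgebra.toSubmodule R).map g.symm.conj.toLinearMap := by rw [heq]; exact hf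
    obtain ⟨f', hf', rfl⟩ := hf'
    have : g.conj (g.symm.conj f') = f' := by ext; simp [LinearEquiv.conj_apply]
    change g.conj (g.symm.conj f') ∈ R
    rw [this]
    exact hf'
  let σ : R ≃+* R :=
    { toFun := fun r => ⟨g.conj r.1, hconj _ r.2⟩
      invFun := fun r => ⟨g.symm.conj r.1, hsymm _ r.2⟩
      left_inv := fun r => Subtype.ext (by ext; simp [LinearEquiv.conj_apply])
      right_inv := fun r => Subtype.ext (by ext; simp [LinearEquiv.conj_apply])
      map_mul' := fun r s => Subtype.ext (by ext; simp [LinearEquiv.conj_apply])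
      map_add' := fun r s => Subtype.ext (by ext; simp [LinearEquiv.conj_apply]) }
  have : RingHomInvPair (σ : R →+* R) (σ.symm : R →+* R) := RingHomInvPair.of_ringEquiv σ
  have : RingHomInvPair (σ.symm : R →+* R) (σ : R →+* R) := RingHomInvPair.symm _ _
  let G : M ≃ₛₗ[(σ : R →+* R)] M :=
    { g with
      map_smul' := fun r x => by
        change g (r.1 x) = (g.conj r.1) (g x)
        simp [LinearEquiv.conj_apply] }
  have hGg (x) : G x = g x := rfl
  have hrmem (j) : ((a j).trans g.symm).toLinearMap ∈ R := by
    rw [hR]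
    intro k x hx
    rw [← hgV, ← hV j k]
    exact ⟨x, hx, by simp⟩
  let V₀ : Submodule R M :=
    { carrier := V 0
      add_mem' := fun hx hy => add_mem hx hy
      zero_mem' := zero_mem _
      smul_mem' := fun r x hx => r.2 0 x hx }
  have hV₀ (x) : x ∈ V₀ ↔ x ∈ V 0 := Iff.rfl
  have hV₀bot : V₀ ≠ ⊥ := fun h => hbot (by
    ext x
    rw [← hV₀, h, Submodule.mem_bot, Submodule.mem_bot])
  have hV₀top : V₀ ≠ ⊤ := fun h => htop (by
    ext x
    rw [← hV₀, h]
    simp)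
  have : IsScalarTower K R M := ⟨fun c r x => rfl⟩
  obtain ⟨c, hc⟩ := exists_smul_eq_smul_of_semilinear (K := K) G (fun c x => map_smul g c x) a
    (fun j => ⟨_, hrmem j⟩) (fun j x => (g.apply_symm_apply (a j x)).symm) hirr hext V₀ hV₀bot
    hV₀top j
  refine ⟨c, LinearMap.ext fun x => ?_⟩
  have hx : g.symm (a j x) = c • x := hc x
  rw [LinearEquiv.symm_apply_eq, map_smul] at hx
  exact hx

theorem exists_pos_le_norm_mul_mul {B κ : Type*} [NormedRing B] [NormedAlgebra ℝ B]
    [FiniteDimensional ℝ B] [Fintype κ] [Nonempty κ] (F : Submodule ℝ B) (g : κ → B)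
    (h : ∀ P ∈ F, ∀ Q ∈ F, P ≠ 0 → Q ≠ 0 → ∃ i, Q * g i * P ≠ 0) :
    ∃ c : ℝ, 0 < c ∧ ∀ P ∈ F, ∀ Q ∈ F, ∃ i, c * ‖P‖ * ‖Q‖ ≤ ‖Q * g i * P‖ := by
  have : ProperSpace B := FiniteDimensional.proper ℝ B
  let X : Set B := Metric.sphere 0 1 ∩ F
  have hX : IsCompact X := (isCompact_sphere 0 1).inter_right F.closed_of_finiteDimensional
  let f : B × B → ℝ := fun x => ∑ i, ‖x.2 * g i * x.1‖
  have hf : Continuous f := by fun_prop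
  obtain ⟨c, hc, hcf⟩ := (hX.prod hX).exists_forall_le' (a := 0) hf.continuousOn (by
    rintro ⟨P, Q⟩ ⟨⟨hP, hPF⟩, hQ, hQF⟩
    obtain ⟨i, hi⟩ := h P hPF Q hQF (ne_zero_of_mem_unit_sphere ⟨P, hP⟩)
      (ne_zero_of_mem_unit_sphere ⟨Q, hQ⟩)
    exact Finset.sum_pos' (fun _ _ => norm_nonneg _) ⟨i, Finset.mem_univ i, norm_pos_iff.2 hi⟩)
  have hcard : (0 : ℝ) < Fintype.card κ := by exact_mod_cast Fintype.card_pos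
  refine ⟨c / Fintype.card κ, div_pos hc hcard, fun P hP Q hQ => ?_⟩
  rcases eq_or_ne P 0 with rfl | hP0
  · exact ⟨Classical.arbitrary κ, by simp⟩
  rcases eq_or_ne Q 0 with rfl | hQ0
  · exact ⟨Classical.arbitrary κ, by simp⟩
  have hP' : 0 < ‖P‖ := norm_pos_iff.2 hP0
  have hQ' : 0 < ‖Q‖ := norm_pos_iff.2 hQ0
  have hsum : c ≤ ∑ i, ‖Q * g i * P‖ / (‖P‖ * ‖Q‖) := by
    refine (hcf (‖P‖⁻¹ • P, ‖Q‖⁻¹ • Q) ⟨⟨?_, F.smul_mem _ hP⟩, ?_, F.smul_mem _ hQ⟩).trans_eq ?_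
    · simp [norm_smul, hP'.ne']
    · simp [norm_smul, hQ'.ne']
    · refine Finset.sum_congr rfl fun i _ => ?_
      simp only [smul_mul_assoc, mul_smul_comm, norm_smul, norm_inv, norm_norm]
      field_simp
  by_contra! hlt
  have : ∑ i, ‖Q * g i * P‖ / (‖P‖ * ‖Q‖) < ∑ _i : κ, c / Fintype.card κ := by
    refine Finset.sum_lt_sum_of_nonempty Finset.univ_nonempty fun i _ => ?_
    rw [div_lt_iff₀ (by positivity), ← mul_assoc]
    exact hlt i
  rw [Finset.sum_const, Finset.card_univ, nsmul_eq_mul, mul_div_cancel₀ _ hcard.ne'] at this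
  exact absurd hsum (not_le.2 this)

theorem wordProd_append_singleton {ℓ d : ℕ} (A : Fin ℓ → Matrix (Fin d) (Fin d) ℝ)
    (I : List (Fin ℓ)) (i : Fin ℓ) : wordProd A (I ++ [i]) = A i * wordProd A I := by
  simp [wordProd, List.foldl_append]

theorem wordProd_append {ℓ d : ℕ} (A : Fin ℓ → Matrix (Fin d) (Fin d) ℝ)
    (I J : List (Fin ℓ)) : wordProd A (I ++ J) = wordProd A J * wordProd A I := by
  induction J using List.reverseRecOn with
  | nil => simp [wordProd]
  | append_singleton J j ih =>
    rw [← List.append_assoc, wordProd_append_singleton, ih, wordProd_append_singleton,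
      Matrix.mul_assoc]

theorem exists_map_eq_succ_of_map_le_succ {K M ι : Type*} [Field K] [AddCommGroup M] [Module K M]
    [FiniteDimensional K M] (a : ι → M ≃ₗ[K] M) (i₀ : ι) (E : ℕ → Submodule K M)
    (hE : ∀ i k, (E k).map (a i).toLinearMap ≤ E (k + 1)) :
    ∃ k₀, ∀ i k, (E (k₀ + k)).map (a i).toLinearMap = E (k₀ + k + 1) := by
  have hfin : ∀ i k, Module.finrank K ((E k).map (a i).toLinearMap) = Module.finrank K (E k) :=
    fun i k => LinearEquiv.finrank_map_eq (a i) (E k)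
  have hmono : Monotone fun k => Module.finrank K (E k) := monotone_nat_of_le_succ fun k => by
    rw [← hfin i₀ k]
    exact Submodule.finrank_mono (hE i₀ k)
  have hbdd : (Set.range fun k => Module.finrank K (E k)).Finite :=
    (Set.finite_Iic (Module.finrank K M)).subset <| by
      rintro _ ⟨k, rfl⟩
      exact Submodule.finrank_le _
  obtain ⟨_, ⟨k₀, rfl⟩, hk₀⟩ := hbdd.exists_maximal (Set.range_nonempty _)
  refine ⟨k₀, fun i k => Submodule.eq_of_le_of_finrank_le (hE i _) ?_⟩
  rw [hfin]
  exact (hk₀ ⟨k₀ + k + 1, rfl⟩ (hmono (by omega))).trans (hmono (by omega))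

theorem exists_length_forall_dotProduct_ne_zero {ℓ d : ℕ} (A : Fin ℓ → Matrix (Fin d) (Fin d) ℝ)
    (i₀ : Fin ℓ) (hA : IsUnit (A i₀))
    (h : ∀ u ≠ 0, ∃ k, ∀ φ ≠ 0, ∃ I : List (Fin ℓ), I.length = k ∧ φ ⬝ᵥ (wordProd A I *ᵥ u) ≠ 0) :
    ∃ k, ∀ u ≠ 0, ∀ φ ≠ 0, ∃ I : List (Fin ℓ), I.length = k ∧ φ ⬝ᵥ (wordProd A I *ᵥ u) ≠ 0 := by
  let S : Set (Fin d → ℝ) := Metric.sphere 0 1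
  let C : ℕ → Set ((Fin d → ℝ) × (Fin d → ℝ)) := fun k =>
    {p | ∀ I : List (Fin ℓ), I.length = k → p.2 ⬝ᵥ (wordProd A I *ᵥ p.1) = 0}
  have hC : ∀ k, IsCompact ((S ×ˢ S) ∩ C k) := fun k => by
    refine ((isCompact_sphere 0 1).prod (isCompact_sphere 0 1)).inter_right ?_
    simp only [C, Set.ofPred_forall]
    refine isClosed_iInter fun I => isClosed_iInter fun _ => isClosed_eq ?_ continuous_const
    exact continuous_snd.dotProduct (continuous_const.matrix_mulVec continuous_fst)
  let T : ℕ → Set (Fin d → ℝ) := fun k => Prod.fst '' ((S ×ˢ S) ∩ C k)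
  have hT : ∀ k, IsCompact (T k) := fun k => (hC k).image continuous_fst
  have hS : ∀ x : Fin d → ℝ, x ≠ 0 → ‖x‖⁻¹ • x ∈ S := fun x hx => by
    simp [S, norm_smul, hx]
  have hanti : ∀ k, T (k + 1) ⊆ T k := by
    rintro k _ ⟨⟨u, φ⟩, ⟨⟨hu, hφ⟩, hC⟩, rfl⟩
    have hne : φ ᵥ* A i₀ ≠ 0 := fun h0 =>
      ne_zero_of_mem_unit_sphere ⟨φ, hφ⟩
        (Matrix.vecMul_injective_iff_isUnit.2 hA (h0.trans (Matrix.zero_vecMul _).symm))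
    refine ⟨(u, ‖φ ᵥ* A i₀‖⁻¹ • (φ ᵥ* A i₀)), ⟨⟨hu, hS _ hne⟩, fun I hI => ?_⟩, rfl⟩
    have := hC (I ++ [i₀]) (by simp [hI])
    rw [wordProd_append_singleton, ← Matrix.mulVec_mulVec, Matrix.dotProduct_mulVec] at this
    simp only [smul_dotProduct]
    rw [this, smul_zero]
  by_contra! hcon
  obtain ⟨u, hu⟩ := IsCompact.nonempty_iInter_of_sequence_nonempty_isCompact_isClosed T hanti
    (fun k => by
      obtain ⟨u, hu, φ, hφ, hI⟩ := hcon k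
      refine ⟨_, (‖u‖⁻¹ • u, ‖φ‖⁻¹ • φ), ⟨⟨hS u hu, hS φ hφ⟩, fun I hk => ?_⟩, rfl⟩
      simp [Matrix.mulVec_smul, hI I hk]) (hT 0) (fun k => (hT k).isClosed)
  rw [Set.mem_iInter] at hu
  obtain ⟨⟨_, _⟩, ⟨⟨hu0, -⟩, -⟩, rfl⟩ := hu 0
  obtain ⟨k, hk⟩ := h _ (ne_zero_of_mem_unit_sphere ⟨_, hu0⟩)
  obtain ⟨⟨_, φ⟩, ⟨⟨-, hφ⟩, hCk⟩, rfl⟩ := hu k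
  obtain ⟨I, hI, hne⟩ := hk φ (ne_zero_of_mem_unit_sphere ⟨φ, hφ⟩)
  exact hne (hCk I hI)

theorem exists_forall_eq_smul_of_dotProduct_eq_zero {ℓ d : ℕ}
    (A : Fin ℓ → Matrix (Fin d) (Fin d) ℝ) (hA : ∀ i, IsUnit (A i))
    (hirr : ∀ t : ℕ, 0 < t → t ∣ d →
      ¬ ∃ V : Submodule ℝ (Fin d → ℝ), V ≠ ⊥ ∧ V ≠ ⊤ ∧
        ∀ I : List (Fin ℓ), I.length = t → V.map (wordProd A I).mulVecLin ≤ V)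
    (hext : ∀ m : ℕ, 1 ≤ m → m ≤ d - 1 →
      ¬ ∃ W : Submodule ℝ (ExteriorAlgebra ℝ (Fin d → ℝ)),
        W ≤ ⋀[ℝ]^m (Fin d → ℝ) ∧ W ≠ ⊥ ∧ W ≠ ⋀[ℝ]^m (Fin d → ℝ) ∧
        ∀ i : Fin ℓ, W.map (ExteriorAlgebra.map (A i).mulVecLin).toLinearMap ≤ W)
    {u : Fin d → ℝ} (hu : u ≠ 0)
    (h : ∀ k, ∃ φ ≠ 0, ∀ I : List (Fin ℓ), I.length = k → φ ⬝ᵥ (wordProd A I *ᵥ u) = 0)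
    (i j : Fin ℓ) : ∃ c : ℝ, A j = c • A i := by
  let a : Fin ℓ → (Fin d → ℝ) ≃ₗ[ℝ] (Fin d → ℝ) := fun i =>
    LinearEquiv.ofInjectiveEndo (A i).mulVecLin (Matrix.mulVec_injective_iff_isUnit.2 (hA i))
  have ha : ∀ i, (a i).toLinearMap = (A i).mulVecLin := fun i => LinearMap.ext fun _ => rfl
  let E : ℕ → Submodule ℝ (Fin d → ℝ) := fun k =>
    Submodule.span ℝ {x | ∃ I : List (Fin ℓ), I.length = k ∧ wordProd A I *ᵥ u = x}
  obtain ⟨k₀, hk₀⟩ := exists_map_eq_succ_of_map_le_succ a i E (fun i k => by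
    rw [Submodule.map_span, Submodule.span_le]
    rintro _ ⟨_, ⟨I, hI, rfl⟩, rfl⟩
    refine Submodule.subset_span ⟨I ++ [i], by simp [hI], ?_⟩
    rw [wordProd_append_singleton, ← Matrix.mulVec_mulVec, ha, Matrix.mulVecLin_apply])
  have hunit : ∀ I : List (Fin ℓ), IsUnit (wordProd A I) := fun I => by
    induction I using List.reverseRecOn with
    | nil => simp [wordProd]
    | append_singleton I j ih =>
      rw [wordProd_append_singleton]
      exact (hA j).mul ih
  have hbot : E (k₀ + 0) ≠ ⊥ := fun h0 => by
    have hmem : wordProd A (List.replicate k₀ i) *ᵥ u ∈ E (k₀ + 0) :=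
      Submodule.subset_span ⟨_, List.length_replicate, rfl⟩
    rw [h0, Submodule.mem_bot] at hmem
    exact hu (Matrix.mulVec_injective_iff_isUnit.2 (hunit _)
      (hmem.trans (Matrix.mulVec_zero _).symm))
  have htop : E (k₀ + 0) ≠ ⊤ := fun h1 => by
    obtain ⟨φ, hφ, hI⟩ := h k₀
    have hle : E (k₀ + 0) ≤ LinearMap.ker (dotProductBilin ℝ ℝ φ) := by
      refine Submodule.span_le.2 ?_
      rintro _ ⟨I, hk, rfl⟩
      exact hI I hk
    have hmem : φ ∈ E (k₀ + 0) := h1 ▸ Submodule.mem_top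
    exact hφ (dotProduct_self_eq_zero.1 (hle hmem))
  obtain ⟨c, hc⟩ := exists_eq_smul_of_map_eq_succ a (fun t ht htd U hU hUt => by
      rw [Module.finrank_fin_fun] at htd
      by_contra! hcon
      refine hirr t ht htd ⟨U 0, hcon.1, hcon.2, fun I hI => ?_⟩
      have hword : ∀ I : List (Fin ℓ), (U 0).map (wordProd A I).mulVecLin = U I.length := by
        intro I
        induction I using List.reverseRecOn with
        | nil => simp [wordProd]
        | append_singleton I j ih =>
          rw [wordProd_append_singleton, Matrix.mulVecLin_mul, Submodule.map_comp, ih, ← ha,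
            hU, List.length_append, List.length_singleton]
      rw [hword, hI, hUt])
    (fun m hm hmd W hW hWb hWi => by
      rw [Module.finrank_fin_fun] at hmd
      by_contra hne
      exact hext m hm (by omega) ⟨W, hW, hWb, hne, fun i => by rw [← ha]; exact hWi i⟩)
    (fun k => E (k₀ + k)) hk₀ hbot htop i j
  refine ⟨c, ?_⟩
  rw [ha, ha] at hc
  apply Matrix.mulVec_injective
  funext x
  rw [Matrix.smul_mulVec]
  exact LinearMap.congr_fun hc x

open scoped Matrix.Norms.L2Operator in
theorem k_quasi_multiplicative_of_irreducible
    (ℓ d : ℕ) (hℓ : 2 ≤ ℓ) (hd : 1 ≤ d)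
    (A : Fin ℓ → Matrix (Fin d) (Fin d) ℝ) (hA : ∀ i, IsUnit (A i))
    (hirr : ∀ t : ℕ, 0 < t → t ∣ d →
      ¬ ∃ V : Submodule ℝ (Fin d → ℝ), V ≠ ⊥ ∧ V ≠ ⊤ ∧
        ∀ I : List (Fin ℓ), I.length = t → V.map (wordProd A I).mulVecLin ≤ V)
    (hext : ∀ m : ℕ, 1 ≤ m → m ≤ d - 1 →
      ¬ ∃ W : Submodule ℝ (ExteriorAlgebra ℝ (Fin d → ℝ)),
        W ≤ ⋀[ℝ]^m (Fin d → ℝ) ∧ W ≠ ⊥ ∧ W ≠ ⋀[ℝ]^m (Fin d → ℝ) ∧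
        ∀ i : Fin ℓ, W.map (ExteriorAlgebra.map (A i).mulVecLin).toLinearMap ≤ W) :
    ∃ k : ℕ, ∃ c : ℝ, 0 < c ∧
      ∀ I J : List (Fin ℓ), ∃ K : List (Fin ℓ), K.length = k ∧
        opNorm (wordProd A (I ++ K ++ J)) ≥ c * opNorm (wordProd A I) * opNorm (wordProd A J) := by
  let i₀ : Fin ℓ := ⟨0, by omega⟩
  have hvec : ∀ P : Matrix (Fin d) (Fin d) ℝ, P ≠ 0 → ∃ x, P *ᵥ x ≠ 0 := fun P hP => by
    by_contra! h0
    exact hP (Matrix.mulVec_injective (funext fun x => by simp [h0]))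
  by_cases h : ∀ u ≠ 0, ∃ k, ∀ φ ≠ 0, ∃ I : List (Fin ℓ),
      I.length = k ∧ φ ⬝ᵥ (wordProd A I *ᵥ u) ≠ 0
  · obtain ⟨k, hk⟩ := exists_length_forall_dotProduct_ne_zero A i₀ (hA i₀) h
    have : Nonempty (List.Vector (Fin ℓ) k) := ⟨List.Vector.replicate k i₀⟩
    obtain ⟨c, hc, hcP⟩ := exists_pos_le_norm_mul_mul (⊤ : Submodule ℝ (Matrix (Fin d) (Fin d) ℝ))
      (fun K : List.Vector (Fin ℓ) k => wordProd A K.toList) (fun P _ Q _ hP hQ => by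
        obtain ⟨x, hx⟩ := hvec P hP
        obtain ⟨y, hy⟩ := hvec Qᵀ (Matrix.transpose_eq_zero.not.2 hQ)
        rw [Matrix.mulVec_transpose] at hy
        obtain ⟨I, hI, hne⟩ := hk _ hx _ hy
        refine ⟨⟨I, hI⟩, fun h0 => hne ?_⟩
        rw [← Matrix.dotProduct_mulVec, Matrix.mulVec_mulVec, Matrix.mulVec_mulVec]
        exact (congrArg (fun R => y ⬝ᵥ R *ᵥ x) h0).trans (by simp))
    refine ⟨k, c, hc, fun I J => ?_⟩
    obtain ⟨K, hK⟩ := hcP (wordProd A I) trivial (wordProd A J) trivial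
    refine ⟨K.toList, K.toList_length, ?_⟩
    rw [wordProd_append, wordProd_append, ← Matrix.mul_assoc]
    exact hK
  · push Not at h
    obtain ⟨u, hu, hφ⟩ := h
    have hsmul := exists_forall_eq_smul_of_dotProduct_eq_zero A hA hirr hext hu hφ i₀
    let F := Algebra.adjoin ℝ {A i₀}
    have hmem : ∀ I, wordProd A I ∈ F := fun I => by
      induction I using List.reverseRecOn with
      | nil => exact F.one_mem
      | append_singleton I j ih =>
        obtain ⟨c, hc⟩ := hsmul j
        rw [wordProd_append_singleton, hc]
        exact F.mul_mem (F.smul_mem (Algebra.subset_adjoin rfl) c) ih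
    have hinj : ∀ Q ∈ F, Q ≠ 0 → LinearMap.ker Q.mulVecLin = ⊥ := fun Q hQ hQ0 => by
      by_contra hker
      refine hirr 1 one_pos (one_dvd d) ⟨LinearMap.ker Q.mulVecLin, hker, fun ht => ?_, ?_⟩
      · obtain ⟨x, hx⟩ := hvec Q hQ0
        exact hx (LinearMap.mem_ker.1 (ht ▸ Submodule.mem_top))
      · intro I _
        rw [Submodule.map_le_iff_le_comap]
        intro x hx
        have hcomm : Commute Q (wordProd A I) :=
          Algebra.commute_of_mem_adjoin_singleton_of_commute (hmem I)
            (Algebra.commute_of_mem_adjoin_self hQ).symm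
        rw [LinearMap.mem_ker, Matrix.mulVecLin_apply] at hx
        rw [Submodule.mem_comap, LinearMap.mem_ker, Matrix.mulVecLin_apply,
          Matrix.mulVecLin_apply, Matrix.mulVec_mulVec, hcomm.eq, ← Matrix.mulVec_mulVec, hx,
          Matrix.mulVec_zero]
    obtain ⟨c, hc, hcP⟩ := exists_pos_le_norm_mul_mul (Subalgebra.toSubmodule F)
      (fun _ : Unit => 1) (fun P hP Q hQ hP0 hQ0 => ⟨(), fun h0 => by
        obtain ⟨x, hx⟩ := hvec P hP0
        refine hx (LinearMap.ker_eq_bot'.1 (hinj Q hQ hQ0) _ ?_)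
        rw [Matrix.mul_one] at h0
        rw [Matrix.mulVecLin_apply, Matrix.mulVec_mulVec, h0, Matrix.zero_mulVec]⟩)
    refine ⟨0, c, hc, fun I J => ⟨[], rfl, ?_⟩⟩
    obtain ⟨_, hK⟩ := hcP _ (hmem I) _ (hmem J)
    rw [List.append_nil, wordProd_append]
    rwa [Matrix.mul_one] at hK
end

section
/- Let (A_1,…,A_ℓ) be invertible d×d real matrices and k ∈ ℕ. If the cocycle is k-uniformly spannable, i.e. for every nonzero u ∈ ℝ^d one has span{A_I u : I a word of length k} = ℝ^d, then it is k-quasi-multiplicative: there exists c > 0 such that for all finite words I, J there exists a word K of length exactly k with ‖A_{IKJ}‖ ≥ c ‖A_I‖ ‖A_J‖. -/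
open Matrix

theorem foldl_mul_eq_wordProd_mul {ℓ d : ℕ} (A : Fin ℓ → Matrix (Fin d) (Fin d) ℝ)
    (I : List (Fin ℓ)) (B : Matrix (Fin d) (Fin d) ℝ) :
    I.foldl (fun B i => A i * B) B = wordProd A I * B := by
  induction I using List.reverseRecOn with
  | nil => simp [wordProd]
  | append_singleton I i ih =>
    simp only [wordProd, List.foldl_append, List.foldl_cons, List.foldl_nil] at ih ⊢
    rw [ih, Matrix.mul_assoc]

/-- If a finite family of operators moves every nonzero vector to a spanning set, then
composing through some member of the family is norm-supermultiplicative up to a constant. -/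
theorem exists_pos_le_norm_comp_comp {ι E F : Type*} [Fintype ι] [Nonempty ι]
    [NormedAddCommGroup E] [NormedSpace ℝ E] [FiniteDimensional ℝ E]
    [NormedAddCommGroup F] [NormedSpace ℝ F] [FiniteDimensional ℝ F]
    (T : ι → E →L[ℝ] F)
    (hT : ∀ u : E, u ≠ 0 → Submodule.span ℝ (Set.range fun i => T i u) = ⊤) :
    ∃ c : ℝ, 0 < c ∧ ∀ (B : E →L[ℝ] E) (C : F →L[ℝ] F),
      ∃ i, c * ‖B‖ * ‖C‖ ≤ ‖C ∘L T i ∘L B‖ := by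
  have : ProperSpace (E →L[ℝ] E) := FiniteDimensional.proper ℝ _
  have : ProperSpace (F →L[ℝ] F) := FiniteDimensional.proper ℝ _
  let f : (E →L[ℝ] E) × (F →L[ℝ] F) → ℝ := fun p =>
    Finset.univ.sup' Finset.univ_nonempty fun i => ‖p.2 ∘L T i ∘L p.1‖
  have hf : Continuous f := Continuous.finset_sup'_apply _ fun i _ =>
    (continuous_snd.clm_comp (continuous_const.clm_comp continuous_fst)).norm
  have hpos : ∀ p ∈ Metric.sphere (0 : E →L[ℝ] E) 1 ×ˢ Metric.sphere (0 : F →L[ℝ] F) 1,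
      0 < f p := by
    rintro ⟨B, C⟩ ⟨hB, hC⟩
    have hB0 : B ≠ 0 := ne_zero_of_mem_unit_sphere ⟨B, hB⟩
    have hC0 : C ≠ 0 := ne_zero_of_mem_unit_sphere ⟨C, hC⟩
    by_contra! hle
    have hzero : ∀ i, C ∘L T i ∘L B = 0 := fun i => norm_le_zero_iff.mp
      ((Finset.le_sup' (fun i => ‖C ∘L T i ∘L B‖) (Finset.mem_univ i)).trans hle)
    obtain ⟨x, hx⟩ := DFunLike.ne_iff.mp hB0
    refine hC0 (ContinuousLinearMap.coe_injective
      (LinearMap.ext_on_range (hT (B x) hx) fun i => ?_))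
    simpa using DFunLike.congr_fun (hzero i) x
  obtain ⟨c, hc, hcf⟩ := ((isCompact_sphere _ _).prod (isCompact_sphere _ _)).exists_forall_le'
    hf.continuousOn hpos
  refine ⟨c, hc, fun B C => ?_⟩
  by_cases hB : B = 0
  · simp [hB]
  by_cases hC : C = 0
  · simp [hC]
  have hle := hcf (‖B‖⁻¹ • B, ‖C‖⁻¹ • C) ⟨by simp [norm_smul, hB], by simp [norm_smul, hC]⟩
  obtain ⟨i, -, hi⟩ := Finset.exists_mem_eq_sup' Finset.univ_nonempty
    fun i => ‖(‖C‖⁻¹ • C) ∘L T i ∘L (‖B‖⁻¹ • B)‖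
  refine ⟨i, ?_⟩
  have hle' : c ≤ ‖B‖⁻¹ * (‖C‖⁻¹ * ‖C ∘L T i ∘L B‖) := by
    simpa [norm_smul] using hle.trans hi.le
  rw [← div_eq_inv_mul, ← div_eq_inv_mul, div_div, le_div_iff₀ (by positivity)] at hle'
  rwa [mul_assoc, mul_comm ‖B‖]

theorem quasi_multiplicative_of_spannable
    (ℓ d : ℕ) (hℓ : 2 ≤ ℓ) (hd : 1 ≤ d)
    (A : Fin ℓ → Matrix (Fin d) (Fin d) ℝ) (hA : ∀ i, IsUnit (A i))
    (k : ℕ)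
    (hspan : ∀ u : Fin d → ℝ, u ≠ 0 →
      Submodule.span ℝ
        {v : Fin d → ℝ | ∃ I : List (Fin ℓ), I.length = k ∧ v = (wordProd A I).mulVec u} = ⊤) :
    ∃ c : ℝ, 0 < c ∧
      ∀ I J : List (Fin ℓ), ∃ K : List (Fin ℓ), K.length = k ∧
        opNorm (wordProd A (I ++ K ++ J)) ≥ c * opNorm (wordProd A I) * opNorm (wordProd A J) := by
  have : NeZero ℓ := ⟨by omega⟩
  have hT : ∀ u : EuclideanSpace ℝ (Fin d), u ≠ 0 → Submodule.span ℝ (Set.range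
      fun K : List.Vector (Fin ℓ) k =>
        Matrix.toEuclideanCLM (𝕜 := ℝ) (wordProd A K.1) u) = ⊤ := by
    intro u hu
    have h := congrArg (Submodule.map (WithLp.linearEquiv 2 ℝ (Fin d → ℝ)).symm.toLinearMap)
      (hspan u.ofLp (by simpa using hu))
    rw [Submodule.map_span, Submodule.map_top, LinearEquiv.range] at h
    rw [← h]
    congr 1
    ext v
    constructor
    · rintro ⟨K, rfl⟩
      exact ⟨_, ⟨K.1, K.2, rfl⟩, rfl⟩
    · rintro ⟨_, ⟨K, hK, rfl⟩, rfl⟩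
      exact ⟨⟨K, hK⟩, rfl⟩
  have : Nonempty (List.Vector (Fin ℓ) k) := ⟨List.Vector.replicate k 0⟩
  obtain ⟨c, hc, h⟩ := exists_pos_le_norm_comp_comp _ hT
  refine ⟨c, hc, fun I J => ?_⟩
  obtain ⟨K, hK⟩ := h (Matrix.toEuclideanCLM (𝕜 := ℝ) (wordProd A I))
    (Matrix.toEuclideanCLM (𝕜 := ℝ) (wordProd A J))
  refine ⟨K.1, K.2, ?_⟩
  rw [wordProd_append, wordProd_append]
  simpa only [opNorm, map_mul, ContinuousLinearMap.mul_def] using hK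
end

section
/- Let (A_1,…,A_ℓ) be invertible d×d real matrices. For u ∈ ℝ^d and k ∈ ℕ set V_{u,k} := span{A_I u : I a word of length k}. Suppose that for every k ∈ ℕ there exists a nonzero vector u_k ∈ ℝ^d with V_{u_k,k} ≠ ℝ^d. Then there exists a single nonzero vector u ∈ ℝ^d such that V_{u,k} ≠ ℝ^d for every k ∈ ℕ. -/
open Matrix

/-- `V_{u,k} = span {A_I u : |I| = k}`. -/
noncomputable def spanV {ℓ d : ℕ} (A : Fin ℓ → Matrix (Fin d) (Fin d) ℝ)
    (u : Fin d → ℝ) (k : ℕ) : Submodule ℝ (Fin d → ℝ) :=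
  Submodule.span ℝ {v : Fin d → ℝ | ∃ I : List (Fin ℓ), I.length = k ∧ v = (wordProd A I).mulVec u}

theorem spanV_ne_top_iff {ℓ d : ℕ} (A : Fin ℓ → Matrix (Fin d) (Fin d) ℝ) (u : Fin d → ℝ) (k : ℕ) :
    spanV A u k ≠ ⊤ ↔
      ∃ w : Fin d → ℝ, w ≠ 0 ∧ ∀ I : List (Fin ℓ), I.length = k → w ⬝ᵥ (wordProd A I *ᵥ u) = 0 := by
  constructor
  · intro h
    obtain ⟨f, hf, hle⟩ := Submodule.exists_le_ker_of_lt_top _ h.lt_top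
    have hfw (v : Fin d → ℝ) : (dotProductEquiv ℝ (Fin d)).symm f ⬝ᵥ v = f v := by
      rw [← dotProductEquiv_apply_apply, LinearEquiv.apply_symm_apply]
    refine ⟨(dotProductEquiv ℝ (Fin d)).symm f, by simpa using hf, fun I hI => ?_⟩
    rw [hfw]
    exact hle (Submodule.subset_span ⟨I, hI, rfl⟩)
  · rintro ⟨w, hw, h⟩ htop
    have hle : spanV A u k ≤ LinearMap.ker (dotProductEquiv ℝ (Fin d) w) := by
      refine Submodule.span_le.2 ?_
      rintro _ ⟨I, hI, rfl⟩
      exact h I hI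
    rw [htop, top_le_iff, LinearMap.ker_eq_top] at hle
    exact hw ((LinearEquiv.map_eq_zero_iff _).1 hle)

theorem spanV_succ_eq_top {ℓ d : ℕ} (A : Fin ℓ → Matrix (Fin d) (Fin d) ℝ) (i : Fin ℓ)
    (hA : IsUnit (A i)) (u : Fin d → ℝ) (k : ℕ) (h : spanV A u k = ⊤) :
    spanV A u (k + 1) = ⊤ := by
  have hmap : (spanV A u k).map (A i).mulVecLin ≤ spanV A u (k + 1) := by
    refine Submodule.map_span_le _ _ _ |>.2 ?_
    rintro _ ⟨I, hI, rfl⟩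
    exact Submodule.subset_span ⟨I ++ [i], by simp [hI], by simp [wordProd]⟩
  have hsurj : Function.Surjective (A i).mulVecLin :=
    Matrix.mulVec_surjective_iff_isUnit.2 hA
  rwa [h, Submodule.map_top, LinearMap.range_eq_top.2 hsurj, top_le_iff] at hmap

theorem isCompact_sphere_inter_spanV_ne_top {ℓ d : ℕ} (A : Fin ℓ → Matrix (Fin d) (Fin d) ℝ)
    (k : ℕ) : IsCompact {u : Fin d → ℝ | ‖u‖ = 1 ∧ spanV A u k ≠ ⊤} := by
  have hclosed : IsClosed {p : (Fin d → ℝ) × (Fin d → ℝ) |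
      ∀ I : List (Fin ℓ), I.length = k → p.2 ⬝ᵥ (wordProd A I *ᵥ p.1) = 0} := by
    simp only [Set.ofPred_forall]
    refine isClosed_iInter fun I => isClosed_iInter fun _ => isClosed_eq ?_ continuous_const
    fun_prop
  have himage := ((((isCompact_sphere (0 : Fin d → ℝ) 1).prod
    (isCompact_sphere (0 : Fin d → ℝ) 1)).inter_right hclosed).image continuous_fst)
  refine (congrArg IsCompact (Set.ext fun u => ?_)).mpr himage
  simp only [spanV_ne_top_iff, Set.mem_ofPred_eq, Set.mem_image, Set.mem_inter_iff, Set.mem_prod,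
    mem_sphere_zero_iff_norm, Prod.exists, exists_and_right, exists_eq_right]
  constructor
  · rintro ⟨hu, w, hw, h⟩
    exact ⟨‖w‖⁻¹ • w, ⟨hu, norm_smul_inv_norm hw⟩, fun I hI => by simp [h I hI]⟩
  · rintro ⟨w, ⟨hu, hw⟩, h⟩
    exact ⟨hu, w, fun h0 => by simp [h0] at hw, h⟩

theorem exists_common_nonspanning_vector
    (ℓ d : ℕ) (hℓ : 2 ≤ ℓ) (hd : 1 ≤ d)
    (A : Fin ℓ → Matrix (Fin d) (Fin d) ℝ) (hA : ∀ i, IsUnit (A i))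
    (h : ∀ k : ℕ, ∃ u : Fin d → ℝ, u ≠ 0 ∧ spanV A u k ≠ ⊤) :
    ∃ u : Fin d → ℝ, u ≠ 0 ∧ ∀ k : ℕ, spanV A u k ≠ ⊤ := by
  have hanti (k : ℕ) : {u : Fin d → ℝ | ‖u‖ = 1 ∧ spanV A u (k + 1) ≠ ⊤} ⊆
      {u | ‖u‖ = 1 ∧ spanV A u k ≠ ⊤} := fun u hu =>
    ⟨hu.1, mt (spanV_succ_eq_top A ⟨0, by omega⟩ (hA _) u k) hu.2⟩
  have hne (k : ℕ) : {u : Fin d → ℝ | ‖u‖ = 1 ∧ spanV A u k ≠ ⊤}.Nonempty := by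
    obtain ⟨u, hu, hk⟩ := h k
    obtain ⟨w, hw, hI⟩ := (spanV_ne_top_iff A u k).1 hk
    exact ⟨‖u‖⁻¹ • u, norm_smul_inv_norm hu,
      (spanV_ne_top_iff A _ k).2 ⟨w, hw, fun I h => by simp [Matrix.mulVec_smul, hI I h]⟩⟩
  obtain ⟨u, hu⟩ := IsCompact.nonempty_iInter_of_sequence_nonempty_isCompact_isClosed _ hanti hne
    (isCompact_sphere_inter_spanV_ne_top A 0)
    fun k => (isCompact_sphere_inter_spanV_ne_top A k).isClosed
  rw [Set.mem_iInter] at hu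
  exact ⟨u, fun h0 => by simpa [h0] using (hu 0).1, fun k => (hu k).2⟩
end

section
/- Let (A_1,…,A_ℓ) be invertible d×d real matrices. Let (V_k)_{k∈ℕ} be a sequence of subspaces of ℝ^d, each of dimension γ ≥ 1, such that A_i V_k = V_{k+1} for every i ∈ {1,…,ℓ} and every k ∈ ℕ. Suppose moreover that γ is minimal: there exists no sequence (W_k)_{k∈ℕ} of subspaces of ℝ^d of common dimension δ with 0 < δ < γ satisfying A_i W_k = W_{k+1} for every i and k. Then for any indices i ≠ j, the subspaces V_i and V_j either coincide or intersect trivially (V_i = V_j or V_i ∩ V_j = {0}). -/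
open Matrix

theorem coincide_or_trivial_intersection
    (ℓ d : ℕ) (hℓ : 2 ≤ ℓ) (hd : 1 ≤ d)
    (A : Fin ℓ → Matrix (Fin d) (Fin d) ℝ) (hA : ∀ i, IsUnit (A i))
    (γ : ℕ) (hγ : 1 ≤ γ)
    (V : ℕ → Submodule ℝ (Fin d → ℝ))
    (hdim : ∀ k : ℕ, Module.finrank ℝ (V k) = γ)
    (hmap : ∀ (i : Fin ℓ) (k : ℕ), (V k).map (A i).mulVecLin = V (k + 1))
    (hmin : ¬ ∃ (W : ℕ → Submodule ℝ (Fin d → ℝ)) (δ : ℕ), 0 < δ ∧ δ < γ ∧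
      (∀ k : ℕ, Module.finrank ℝ (W k) = δ) ∧
      ∀ (i : Fin ℓ) (k : ℕ), (W k).map (A i).mulVecLin = W (k + 1)) :
    ∀ i j : ℕ, i ≠ j → V i = V j ∨ V i ⊓ V j = ⊥ := by
  intro i j _
  have hinj : ∀ m, Function.Injective (A m).mulVecLin := fun m =>
    Matrix.mulVec_injective_of_isUnit (hA m)
  have hW : ∀ (m : Fin ℓ) (k : ℕ), (V (i + k) ⊓ V (j + k)).map (A m).mulVecLin =
      V (i + (k + 1)) ⊓ V (j + (k + 1)) := fun m k => by
    rw [Submodule.map_inf _ (hinj m), hmap, hmap, add_assoc, add_assoc]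
  have hfin : ∀ k, Module.finrank ℝ ↥(V (i + k) ⊓ V (j + k)) =
      Module.finrank ℝ ↥(V i ⊓ V j) := fun k => by
    induction k with
    | zero => rfl
    | succ k ih =>
      rw [← hW ⟨0, by lia⟩ k, ← (Submodule.equivMapOfInjective _ (hinj _) _).finrank_eq, ih]
  rcases Nat.eq_zero_or_pos (Module.finrank ℝ ↥(V i ⊓ V j)) with h0 | hpos
  · exact .inr (Submodule.finrank_eq_zero.mp h0)
  · have hge : γ ≤ Module.finrank ℝ ↥(V i ⊓ V j) := by
      by_contra! hlt
      exact hmin ⟨fun k => V (i + k) ⊓ V (j + k), _, hpos, hlt, hfin, hW⟩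
    have hi : V i ⊓ V j = V i :=
      Submodule.eq_of_le_of_finrank_le inf_le_left ((hdim i).trans_le hge)
    have hj : V i ⊓ V j = V j :=
      Submodule.eq_of_le_of_finrank_le inf_le_right ((hdim j).trans_le hge)
    exact .inl (hi.symm.trans hj)
end

section
/- Let (A_1,…,A_ℓ) be invertible d×d real matrices, s ≥ 0, and let μ be a σ-invariant Borel probability measure on Σ_ℓ satisfying the Gibbs property for Φ_𝒜^s with pressure P ∈ ℝ and constant C_0 > 1. Suppose the cocycle is m-quasi-multiplicative with constant C_1 > 0: for all finite words I, J there exists a word K of length exactly m with ‖A_{IKJ}‖ ≥ C_1 ‖A_I‖ ‖A_J‖. Then there exists κ > 0 such that for all Borel sets X, Y ⊆ Σ_ℓ, liminf_{n→∞} μ(X ∩ σ^{−n} Y) ≥ κ μ(X) μ(Y). -/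
open Matrix MeasureTheory

/-- The left shift on the full one-sided shift space `Σ_ℓ = {1,…,ℓ}^ℕ`. -/
def shift (ℓ : ℕ) : (ℕ → Fin ℓ) → (ℕ → Fin ℓ) := fun x n => x (n + 1)

/-- The cylinder set `[I]` of sequences starting with the word `I`. -/
def cylinder {ℓ : ℕ} (I : List (Fin ℓ)) : Set (ℕ → Fin ℓ) :=
  {x | ∀ k : Fin I.length, x k = I.get k}

/-- The first `n` letters of a sequence. -/
def firstLetters {α : Type*} (n : ℕ) (x : ℕ → α) : Fin n → α := fun i => x i

theorem measurable_firstLetters {α : Type*} [MeasurableSpace α] (n : ℕ) :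
    Measurable (firstLetters (α := α) n) :=
  measurable_pi_lambda _ fun _ => measurable_pi_apply _

theorem mem_cylinder_iff {ℓ : ℕ} {I : List (Fin ℓ)} {x : ℕ → Fin ℓ} :
    x ∈ cylinder I ↔ ∀ (k : ℕ) (hk : k < I.length), x k = I[k] :=
  ⟨fun h k hk => h ⟨k, hk⟩, fun h k => h k k.2⟩

theorem shift_iterate_apply {ℓ : ℕ} (n : ℕ) (x : ℕ → Fin ℓ) (k : ℕ) :
    (shift ℓ)^[n] x k = x (n + k) := by
  induction n generalizing x with
  | zero => simp
  | succ n ih =>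
    rw [Function.iterate_succ_apply, ih]
    simp only [shift]
    congr 1
    omega

theorem measurable_shift (ℓ : ℕ) : Measurable (shift ℓ) :=
  measurable_pi_lambda _ fun _ => measurable_pi_apply _

theorem cylinder_append {ℓ : ℕ} (I J : List (Fin ℓ)) :
    cylinder (I ++ J) = cylinder I ∩ (shift ℓ)^[I.length] ⁻¹' cylinder J := by
  ext x
  simp only [Set.mem_inter_iff, Set.mem_preimage, mem_cylinder_iff, shift_iterate_apply]
  constructor
  · intro h
    refine ⟨fun k hk => ?_, fun k hk => ?_⟩
    · rw [h k (by simp; omega), List.getElem_append_left hk]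
    · rw [h (I.length + k) (by simp; omega), List.getElem_append_right (by omega)]
      simp
  · rintro ⟨h₁, h₂⟩ k hk
    by_cases hkI : k < I.length
    · rw [List.getElem_append_left hkI, h₁ k hkI]
    · rw [List.getElem_append_right (by omega), ← h₂ (k - I.length) (by simp at hk; omega)]
      congr 1
      omega

theorem cylinder_ofFn {ℓ n : ℕ} (w : Fin n → Fin ℓ) :
    cylinder (List.ofFn w) = firstLetters n ⁻¹' {w} := by
  ext x
  simp only [mem_cylinder_iff, Set.mem_preimage, Set.mem_singleton_iff, funext_iff, firstLetters]
  constructor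
  · intro h i
    simpa using h i (by simp)
  · intro h k hk
    simpa using h ⟨k, by simpa using hk⟩

theorem measurableSet_cylinder {ℓ : ℕ} (I : List (Fin ℓ)) : MeasurableSet (cylinder I) := by
  rw [← List.ofFn_get I, cylinder_ofFn]
  exact measurable_firstLetters _ (MeasurableSet.singleton _)

theorem opNorm_nonneg {d : ℕ} (M : Matrix (Fin d) (Fin d) ℝ) : 0 ≤ opNorm M := norm_nonneg _

theorem sum_measureReal_cylinder_ofFn {ℓ : ℕ} (μ : Measure (ℕ → Fin ℓ)) [IsProbabilityMeasure μ]
    (n : ℕ) : ∑ w : Fin n → Fin ℓ, μ.real (cylinder (List.ofFn w)) = 1 := by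
  simp_rw [cylinder_ofFn]
  rw [sum_measureReal_preimage_singleton _
    fun w _ => measurable_firstLetters n (MeasurableSet.singleton w)]
  simp

theorem mul_le_of_weighted_bounds {c q p₁ p₂ p₃ p e₁ e₂ e₃ e t a₁ a₂ a₃ a : ℝ}
    (hc : 0 ≤ c) (hq : 0 ≤ q) (hp₁ : 0 ≤ p₁) (hp₂ : 0 ≤ p₂) (hp₃ : 0 ≤ p₃)
    (he₁ : 0 < e₁) (he₂ : 0 < e₂) (he₃ : 0 < e₃) (he : 0 < e) (hexp : e * t = e₁ * e₂ * e₃)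
    (h₁ : c * (e₁ * p₁) ≤ a₁) (h₂ : c * (e₂ * p₂) ≤ a₂) (h₃ : c * (e₃ * p₃) ≤ a₃)
    (hprod : q * (a₁ * a₂ * a₃) ≤ a) (h : c * a ≤ e * p) :
    c ^ 4 * q * t * (p₁ * p₂ * p₃) ≤ p := by
  refine le_of_mul_le_mul_left ?_ he
  have ha₁ : 0 ≤ a₁ := le_trans (by positivity) h₁
  have ha₂ : 0 ≤ a₂ := le_trans (by positivity) h₂
  calc _ = c ^ 4 * q * (e * t) * (p₁ * p₂ * p₃) := by ring
    _ = c * (q * ((c * (e₁ * p₁)) * (c * (e₂ * p₂)) * (c * (e₃ * p₃)))) := by rw [hexp]; ring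
    _ ≤ c * (q * (a₁ * a₂ * a₃)) := by gcongr
    _ ≤ c * a := by gcongr
    _ ≤ _ := h

/-- If the connecting words can be chosen with length `m`, a Gibbs measure gives each glued
cylinder at least a fixed multiple of the product of the masses of the three glued pieces. -/
theorem exists_glued_cylinder_ge {ℓ d : ℕ} {A : Fin ℓ → Matrix (Fin d) (Fin d) ℝ} {s : ℝ}
    (hs : 0 ≤ s) {μ : Measure (ℕ → Fin ℓ)} {P C₀ : ℝ} (hC₀ : 0 < C₀)
    (hGibbs : ∀ I : List (Fin ℓ),
      C₀⁻¹ * opNorm (wordProd A I) ^ s ≤ Real.exp (I.length * P) * μ.real (cylinder I) ∧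
      Real.exp (I.length * P) * μ.real (cylinder I) ≤ C₀ * opNorm (wordProd A I) ^ s)
    {m : ℕ} {C₁ : ℝ} (hC₁ : 0 < C₁)
    (hqm : ∀ I J : List (Fin ℓ), ∃ K : List (Fin ℓ), K.length = m ∧
      opNorm (wordProd A (I ++ K ++ J)) ≥ C₁ * opNorm (wordProd A I) * opNorm (wordProd A J))
    (I W J : List (Fin ℓ)) :
    ∃ K L : List (Fin ℓ), K.length = m ∧ L.length = m ∧
      (C₀⁻¹ ^ 4 * (C₁ * C₁) ^ s * Real.exp (-(2 * m * P))) *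
        (μ.real (cylinder I) * μ.real (cylinder J) * μ.real (cylinder W)) ≤
      μ.real (cylinder (I ++ K ++ W ++ L ++ J)) := by
  obtain ⟨K, hK, hIW⟩ := hqm I W
  obtain ⟨L, hL, hWJ⟩ := hqm (I ++ K ++ W) J
  refine ⟨K, L, hK, hL, ?_⟩
  have hnorm : (C₁ * C₁) ^ s * (opNorm (wordProd A I) ^ s * opNorm (wordProd A J) ^ s *
      opNorm (wordProd A W) ^ s) ≤ opNorm (wordProd A (I ++ K ++ W ++ L ++ J)) ^ s := by
    have hI := opNorm_nonneg (wordProd A I)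
    have hJ := opNorm_nonneg (wordProd A J)
    have hW := opNorm_nonneg (wordProd A W)
    rw [← Real.mul_rpow hI hJ, ← Real.mul_rpow (by positivity) hW,
      ← Real.mul_rpow (by positivity) (by positivity)]
    refine Real.rpow_le_rpow (by positivity) ?_ hs
    calc _ = C₁ * (C₁ * opNorm (wordProd A I) * opNorm (wordProd A W)) *
          opNorm (wordProd A J) := by ring
      _ ≤ C₁ * opNorm (wordProd A (I ++ K ++ W)) * opNorm (wordProd A J) := by gcongr
      _ ≤ _ := hWJ
  have hupper (V : List (Fin ℓ)) : C₀⁻¹ * (Real.exp (V.length * P) * μ.real (cylinder V)) ≤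
      opNorm (wordProd A V) ^ s := by
    rw [inv_mul_le_iff₀ hC₀]
    exact (hGibbs V).2
  have hlower := (hGibbs (I ++ K ++ W ++ L ++ J)).1
  have hexp : Real.exp ((I ++ K ++ W ++ L ++ J).length * P) * Real.exp (-(2 * m * P)) =
      Real.exp (I.length * P) * Real.exp (J.length * P) * Real.exp (W.length * P) := by
    rw [← Real.exp_add, ← Real.exp_add, ← Real.exp_add]
    congr 1
    simp only [List.length_append, hK, hL]
    push_cast
    ring
  exact mul_le_of_weighted_bounds (inv_nonneg.2 hC₀.le) (Real.rpow_nonneg (by positivity) s)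
    measureReal_nonneg measureReal_nonneg measureReal_nonneg (Real.exp_pos _) (Real.exp_pos _)
    (Real.exp_pos _) (Real.exp_pos _) hexp (hupper I) (hupper J) (hupper W) hnorm hlower

theorem cylinder_append_five_subset {ℓ : ℕ} (I K W L J : List (Fin ℓ)) :
    cylinder (I ++ K ++ W ++ L ++ J) ⊆
      cylinder I ∩ (shift ℓ)^[I.length + K.length + W.length + L.length] ⁻¹' cylinder J ∩
        (shift ℓ)^[I.length + K.length] ⁻¹' cylinder W := by
  intro x hx
  simp only [cylinder_append, Set.mem_inter_iff, List.length_append] at hx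
  exact ⟨⟨hx.1.1.1.1, hx.2⟩, hx.1.1.2⟩

/-- Summing the glued cylinders over all middle words bounds the correlation of two cylinders. -/
theorem mul_measureReal_cylinder_le_correlation {ℓ : ℕ} {μ : Measure (ℕ → Fin ℓ)}
    [IsProbabilityMeasure μ] {κ : ℝ} {m : ℕ}
    (hglue : ∀ I W J : List (Fin ℓ), ∃ K L : List (Fin ℓ), K.length = m ∧ L.length = m ∧
      κ * (μ.real (cylinder I) * μ.real (cylinder J) * μ.real (cylinder W)) ≤
        μ.real (cylinder (I ++ K ++ W ++ L ++ J)))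
    (I J : List (Fin ℓ)) {n : ℕ} (hn : I.length + 2 * m ≤ n) :
    κ * (μ.real (cylinder I) * μ.real (cylinder J)) ≤
      μ.real (cylinder I ∩ (shift ℓ)^[n] ⁻¹' cylinder J) := by
  obtain ⟨r, rfl⟩ := Nat.exists_eq_add_of_le hn
  set B := cylinder I ∩ (shift ℓ)^[I.length + 2 * m + r] ⁻¹' cylinder J
  have hB : MeasurableSet B :=
    (measurableSet_cylinder I).inter ((measurable_shift ℓ).iterate _ (measurableSet_cylinder J))
  let F : (Fin r → Fin ℓ) → Set (ℕ → Fin ℓ) := fun w =>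
    B ∩ (shift ℓ)^[I.length + m] ⁻¹' cylinder (List.ofFn w)
  have hF (w) : κ * (μ.real (cylinder I) * μ.real (cylinder J)) *
      μ.real (cylinder (List.ofFn w)) ≤ μ.real (F w) := by
    obtain ⟨K, L, hK, hL, h⟩ := hglue I (List.ofFn w) J
    rw [mul_assoc]
    refine h.trans (measureReal_mono ?_)
    have hsub := cylinder_append_five_subset I K (List.ofFn w) L J
    rw [hK, hL, List.length_ofFn,
      show I.length + m + r + m = I.length + 2 * m + r by ring] at hsub
    exact hsub
  have hmeas (w) : MeasurableSet (F w) :=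
    hB.inter ((measurable_shift ℓ).iterate _ (measurableSet_cylinder _))
  have hdisj : Pairwise (Function.onFun Disjoint F) := by
    intro v w hvw
    refine Set.disjoint_left.2 fun x hv hw => hvw ?_
    have hv' := hv.2
    have hw' := hw.2
    simp only [cylinder_ofFn, Set.mem_preimage, Set.mem_singleton_iff] at hv' hw'
    rw [← hv', hw']
  calc _ = ∑ w : Fin r → Fin ℓ, κ * (μ.real (cylinder I) * μ.real (cylinder J)) *
        μ.real (cylinder (List.ofFn w)) := by
        rw [← Finset.mul_sum, sum_measureReal_cylinder_ofFn, mul_one]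
    _ ≤ ∑ w, μ.real (F w) := Finset.sum_le_sum fun w _ => hF w
    _ = μ.real (⋃ w, F w) := (measureReal_iUnion_fintype hdisj hmeas).symm
    _ ≤ μ.real B := measureReal_mono (Set.iUnion_subset fun w => Set.inter_subset_left)

theorem mul_measureReal_firstLetters_le_correlation {ℓ : ℕ} {μ : Measure (ℕ → Fin ℓ)}
    [IsProbabilityMeasure μ] {κ : ℝ} {m : ℕ}
    (hcyl : ∀ (I J : List (Fin ℓ)) (n : ℕ), I.length + 2 * m ≤ n →
      κ * (μ.real (cylinder I) * μ.real (cylinder J)) ≤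
        μ.real (cylinder I ∩ (shift ℓ)^[n] ⁻¹' cylinder J))
    {a b : ℕ} (S : Set (Fin a → Fin ℓ)) (T : Set (Fin b → Fin ℓ)) {n : ℕ} (hn : a + 2 * m ≤ n) :
    κ * (μ.real (firstLetters a ⁻¹' S) * μ.real (firstLetters b ⁻¹' T)) ≤
      μ.real (firstLetters a ⁻¹' S ∩ (shift ℓ)^[n] ⁻¹' (firstLetters b ⁻¹' T)) := by
  classical
  let G : (ℕ → Fin ℓ) → (Fin a → Fin ℓ) × (Fin b → Fin ℓ) := fun x =>
    (firstLetters a x, firstLetters b ((shift ℓ)^[n] x))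
  have hG : Measurable G := (measurable_firstLetters a).prodMk
    ((measurable_firstLetters b).comp ((measurable_shift ℓ).iterate n))
  have hS := sum_measureReal_preimage_singleton (μ := μ) S.toFinset (f := firstLetters a)
    fun w _ => measurable_firstLetters a (MeasurableSet.singleton w)
  have hT := sum_measureReal_preimage_singleton (μ := μ) T.toFinset (f := firstLetters b)
    fun w _ => measurable_firstLetters b (MeasurableSet.singleton w)
  have hST := sum_measureReal_preimage_singleton (μ := μ) (S.toFinset ×ˢ T.toFinset) (f := G)
    fun w _ => hG (MeasurableSet.singleton w)
  have hpre : G ⁻¹' (↑(S.toFinset ×ˢ T.toFinset)) =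
      firstLetters a ⁻¹' S ∩ (shift ℓ)^[n] ⁻¹' (firstLetters b ⁻¹' T) := by
    ext x
    simp [G]
  rw [Set.coe_toFinset] at hS hT
  rw [← hpre, ← hST, ← hS, ← hT, Finset.sum_mul_sum, ← Finset.sum_product', Finset.mul_sum]
  refine Finset.sum_le_sum fun p _ => ?_
  have h := hcyl (List.ofFn p.1) (List.ofFn p.2) n (by simpa using hn)
  rw [cylinder_ofFn, cylinder_ofFn] at h
  have hpre' : G ⁻¹' {p} =
      firstLetters a ⁻¹' {p.1} ∩ (shift ℓ)^[n] ⁻¹' (firstLetters b ⁻¹' {p.2}) := by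
    ext x
    simp [G, Prod.ext_iff]
  rwa [hpre']

/-- Every measurable set is approximated in measure by sets depending on finitely many letters. -/
theorem exists_firstLetters_symmDiff_lt {ℓ : ℕ} (μ : Measure (ℕ → Fin ℓ)) [IsProbabilityMeasure μ]
    {X : Set (ℕ → Fin ℓ)} (hX : MeasurableSet X) {ε : ℝ} (hε : 0 < ε) :
    ∃ (a : ℕ) (S : Set (Fin a → Fin ℓ)), μ.real (symmDiff X (firstLetters a ⁻¹' S)) < ε := by
  have halg : IsSetAlgebra (measurableCylinders fun _ : ℕ => Fin ℓ) :=
    ⟨empty_mem_measurableCylinders _, fun _ => compl_mem_measurableCylinders,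
      fun _ _ => union_mem_measurableCylinders⟩
  obtain ⟨t, ht, hlt⟩ := (Measure.MeasureDense.of_generateFrom_isSetAlgebra_finite μ halg
    generateFrom_measurableCylinders.symm).approx X hX (measure_ne_top _ _) ε hε
  simp only [measurableCylinders_nat, Set.mem_iUnion, Set.mem_singleton_iff] at ht
  obtain ⟨a, S, -, rfl⟩ := ht
  refine ⟨a + 1, {w | (fun i : Finset.Iic a =>
    w ⟨i, Nat.lt_succ_of_le (Finset.mem_Iic.1 i.2)⟩) ∈ S}, ?_⟩
  exact (ENNReal.lt_ofReal_iff_toReal_lt (measure_ne_top _ _)).1 hlt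

theorem measureReal_le_add_symmDiff {α : Type*} [MeasurableSpace α] (μ : Measure α)
    [IsFiniteMeasure μ] (s t : Set α) : μ.real s ≤ μ.real t + μ.real (symmDiff s t) := by
  refine (measureReal_mono fun x hx => ?_).trans (measureReal_union_le t (symmDiff s t))
  by_cases hxt : x ∈ t
  · exact Or.inl hxt
  · exact Or.inr (Or.inl ⟨hx, hxt⟩)

theorem measureReal_correlation_le_add {α : Type*} [MeasurableSpace α] {μ : Measure α}
    [IsFiniteMeasure μ] {f : α → α} (hf : MeasurePreserving f μ μ) {X X' Y Y' : Set α}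
    (hY : MeasurableSet Y) (hY' : MeasurableSet Y') :
    μ.real (X' ∩ f ⁻¹' Y') ≤
      μ.real (X ∩ f ⁻¹' Y) + (μ.real (symmDiff X X') + μ.real (symmDiff Y Y')) := by
  have hpre : μ.real (f ⁻¹' symmDiff Y Y') = μ.real (symmDiff Y Y') :=
    hf.measureReal_preimage (hY.symmDiff hY').nullMeasurableSet
  rw [← hpre]
  have hsub : X' ∩ f ⁻¹' Y' ⊆ X ∩ f ⁻¹' Y ∪ (symmDiff X X' ∪ f ⁻¹' symmDiff Y Y') := by
    rintro x ⟨hxX', hxY'⟩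
    by_cases hxX : x ∈ X
    · by_cases hxY : f x ∈ Y
      · exact Or.inl ⟨hxX, hxY⟩
      · exact Or.inr (Or.inr (Or.inr ⟨hxY', hxY⟩))
    · exact Or.inr (Or.inl (Or.inr ⟨hxX', hxX⟩))
  refine (measureReal_mono hsub).trans ((measureReal_union_le _ _).trans ?_)
  gcongr
  exact measureReal_union_le _ _

open Filter in
theorem gibbs_liminf_lower_bound
    (ℓ d : ℕ) (hℓ : 2 ≤ ℓ) (hd : 1 ≤ d)
    (A : Fin ℓ → Matrix (Fin d) (Fin d) ℝ) (hA : ∀ i, IsUnit (A i))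
    (s : ℝ) (hs : 0 ≤ s)
    (μ : Measure (ℕ → Fin ℓ)) [IsProbabilityMeasure μ]
    (hinv : MeasurePreserving (shift ℓ) μ μ)
    (P : ℝ) (C₀ : ℝ) (hC₀ : 1 < C₀)
    (hGibbs : ∀ I : List (Fin ℓ),
      C₀⁻¹ * opNorm (wordProd A I) ^ s ≤ Real.exp (I.length * P) * (μ (cylinder I)).toReal ∧
      Real.exp (I.length * P) * (μ (cylinder I)).toReal ≤ C₀ * opNorm (wordProd A I) ^ s)
    (m : ℕ) (C₁ : ℝ) (hC₁ : 0 < C₁)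
    (hqm : ∀ I J : List (Fin ℓ), ∃ K : List (Fin ℓ), K.length = m ∧
      opNorm (wordProd A (I ++ K ++ J)) ≥ C₁ * opNorm (wordProd A I) * opNorm (wordProd A J)) :
    ∃ κ : ℝ, 0 < κ ∧ ∀ X Y : Set (ℕ → Fin ℓ), MeasurableSet X → MeasurableSet Y →
      κ * (μ X).toReal * (μ Y).toReal ≤
        liminf (fun n : ℕ => (μ (X ∩ (shift ℓ)^[n] ⁻¹' Y)).toReal) atTop := by
  have hC₀' : 0 < C₀ := by linarith
  set κ := C₀⁻¹ ^ 4 * (C₁ * C₁) ^ s * Real.exp (-(2 * m * P))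
  have hκ : 0 < κ := by positivity
  have hloc {a b : ℕ} (S : Set (Fin a → Fin ℓ)) (T : Set (Fin b → Fin ℓ)) {n : ℕ}
      (hn : a + 2 * m ≤ n) := mul_measureReal_firstLetters_le_correlation
    (fun I J n => mul_measureReal_cylinder_le_correlation
      (exists_glued_cylinder_ge hs hC₀' hGibbs hC₁ hqm) I J) S T hn
  refine ⟨κ, hκ, fun X Y hX hY => ?_⟩
  change κ * μ.real X * μ.real Y ≤
    liminf (fun n : ℕ => μ.real (X ∩ (shift ℓ)^[n] ⁻¹' Y)) atTop
  refine le_of_forall_pos_le_add fun ε hε => ?_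
  obtain ⟨δ, hδ, hδε⟩ : ∃ δ > 0, (2 * κ + 2) * δ = ε :=
    ⟨ε / (2 * κ + 2), by positivity, by field_simp⟩
  obtain ⟨a, S, hS⟩ := exists_firstLetters_symmDiff_lt μ hX hδ
  obtain ⟨b, T, hT⟩ := exists_firstLetters_symmDiff_lt μ hY hδ
  set X' := firstLetters a ⁻¹' S
  set Y' := firstLetters b ⁻¹' T
  have hY' : MeasurableSet Y' := measurable_firstLetters b T.toFinite.measurableSet
  have hprod : κ * μ.real X * μ.real Y ≤ κ * (μ.real X' * μ.real Y') + 2 * κ * δ := by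
    have hXX' := measureReal_le_add_symmDiff μ X X'
    have hYY' := measureReal_le_add_symmDiff μ Y Y'
    have h : μ.real X * μ.real Y ≤ μ.real X' * μ.real Y' + 2 * δ := by
      nlinarith [measureReal_nonneg (μ := μ) (s := X'), measureReal_nonneg (μ := μ) (s := Y),
        measureReal_le_one (μ := μ) (s := X'), measureReal_le_one (μ := μ) (s := Y)]
    nlinarith
  rw [← sub_le_iff_le_add]
  refine le_liminf_of_le
    (isBoundedUnder_of ⟨1, fun n => measureReal_le_one⟩).isCoboundedUnder_ge ?_
  filter_upwards [eventually_ge_atTop (a + 2 * m)] with n hn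
  have h₁ := hloc S T hn
  have h₂ := measureReal_correlation_le_add (hinv.iterate n) (X := X) (X' := X') hY hY'
  linarith
end
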